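/- Let K be an infinite field and let n, n₀, t, t₀ be positive integers with n ≥ n₀ ≥ 2, t₀ ≤ n₀(n₀−1)/2, and 2t ≥ n(n−1) − n₀(n₀−1) + 2t₀. Then every finite-dimensional 2-step nilpotent Lie algebra L over K with dim L/[L,L] = n and dim [L,L] = t admits a surjective Lie algebra homomorphism onto some finite-dimensional 2-step nilpotent Lie algebra M with dim M/[M,M] = n₀ and dim [M,M] = t₀. -/

import Mathlib

/-- A Lie ring is 2-step nilpotent if `⁅L,⁅L,L⁆⁆ = 0` and `⁅L,L⁆ ≠ 0`. -/
def Is2StepNilpotent (L : Type) [LieRing L] : Prop :=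
  (∀ x y z : L, ⁅x, ⁅y, z⁆⁆ = 0) ∧ ¬ (∀ x y : L, ⁅x, y⁆ = 0)

/-- The commutator ideal `[L,L]`, viewed as a submodule of `L`. -/
def commSubmodule (K L : Type) [Field K] [LieRing L] [LieAlgebra K L] : Submodule K L :=
  LieSubmodule.toSubmodule ⁅(⊤ : LieIdeal K L), (⊤ : LieIdeal K L)⁆

/-- `L` belongs to the class `𝔑₂^K(n,t)`: it is 2-step nilpotent with
`dim L/[L,L] = n` and `dim [L,L] = t`. -/
def MemN2 (K L : Type) [Field K] [LieRing L] [LieAlgebra K L] (n t : ℕ) : Prop :=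
  Is2StepNilpotent L ∧
    Module.finrank K (L ⧸ commSubmodule K L) = n ∧
    Module.finrank K (commSubmodule K L) = t

/-- Property `Σ(n₀,t₀)`: `L` admits a surjective Lie algebra homomorphism onto some
finite-dimensional 2-step nilpotent Lie algebra `M` with `dim M/[M,M] = n₀`,
`dim [M,M] = t₀`. -/
def HasSigma (K : Type) [Field K] (L : Type) [LieRing L] [LieAlgebra K L]
    (n₀ t₀ : ℕ) : Prop :=
  ∃ (M : Type) (_ : LieRing M) (_ : LieAlgebra K M) (_ : Module.Finite K M),
    MemN2 K M n₀ t₀ ∧ ∃ f : L →ₗ⁅K⁆ M, Function.Surjective f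

theorem commSubmodule_eq_span (K L : Type) [Field K] [LieRing L] [LieAlgebra K L] :
    commSubmodule K L = Submodule.span K {m | ∃ x y : L, ⁅x, y⁆ = m} := by
  rw [commSubmodule, LieSubmodule.lieIdeal_oper_eq_linear_span']
  simp

theorem lie_mem_commSubmodule (K : Type) {L : Type} [Field K] [LieRing L] [LieAlgebra K L]
    (x y : L) : ⁅x, y⁆ ∈ commSubmodule K L := by
  rw [commSubmodule_eq_span]
  exact Submodule.subset_span ⟨x, y, rfl⟩

theorem lie_eq_zero_of_mem_commSubmodule {K L : Type} [Field K] [LieRing L] [LieAlgebra K L]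
    (h : ∀ x y z : L, ⁅x, ⁅y, z⁆⁆ = 0) {c : L} (hc : c ∈ commSubmodule K L) (x : L) :
    ⁅x, c⁆ = 0 := by
  rw [commSubmodule_eq_span] at hc
  induction hc using Submodule.span_induction with
  | mem c hc => obtain ⟨y, z, rfl⟩ := hc; exact h x y z
  | zero => simp
  | add a b _ _ ha hb => simp [ha, hb]
  | smul a b _ hb => simp [hb]

theorem commSubmodule_quotient (K L : Type) [Field K] [LieRing L] [LieAlgebra K L]
    (I : LieIdeal K L) :
    commSubmodule K (L ⧸ I) = (commSubmodule K L).map I.toSubmodule.mkQ := by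
  rw [commSubmodule_eq_span, commSubmodule_eq_span, Submodule.map_span]
  congr 1
  ext m
  constructor
  · rintro ⟨x, y, rfl⟩
    obtain ⟨x, rfl⟩ := LieSubmodule.Quotient.surjective_mk' I x
    obtain ⟨y, rfl⟩ := LieSubmodule.Quotient.surjective_mk' I y
    exact ⟨⁅x, y⁆, ⟨x, y, rfl⟩, rfl⟩
  · rintro ⟨_, ⟨x, y, rfl⟩, rfl⟩
    exact ⟨LieSubmodule.Quotient.mk' I x, LieSubmodule.Quotient.mk' I y, rfl⟩

/-- The derived algebra of `L ⧸ I` has dimension `dim [L,L] - dim ([L,L] ∩ I)`. -/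
theorem finrank_commSubmodule_quotient_add (K L : Type) [Field K] [LieRing L] [LieAlgebra K L]
    [Module.Finite K L] (I : LieIdeal K L) :
    Module.finrank K (commSubmodule K (L ⧸ I)) +
      Module.finrank K (commSubmodule K L ⊓ I.toSubmodule : Submodule K L) =
      Module.finrank K (commSubmodule K L) := by
  have h := LinearMap.finrank_range_add_finrank_ker
    (I.toSubmodule.mkQ.domRestrict (commSubmodule K L))
  rw [LinearMap.range_domRestrict, LinearMap.ker_domRestrict, Submodule.ker_mkQ] at h
  rw [commSubmodule_quotient, ← Submodule.map_comap_subtype, Submodule.finrank_map_subtype_eq]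
  exact h

theorem finrank_lieQuotient_add (K L : Type) [Field K] [LieRing L] [LieAlgebra K L]
    [Module.Finite K L] (I : LieIdeal K L) :
    Module.finrank K (L ⧸ I) + Module.finrank K I.toSubmodule = Module.finrank K L :=
  Submodule.finrank_quotient_add_finrank I.toSubmodule

theorem lie_lie_quotient_eq_zero {K L : Type} [Field K] [LieRing L] [LieAlgebra K L]
    (h : ∀ x y z : L, ⁅x, ⁅y, z⁆⁆ = 0) (I : LieIdeal K L) (x y z : L ⧸ I) :
    ⁅x, ⁅y, z⁆⁆ = 0 := by
  obtain ⟨x, rfl⟩ := LieSubmodule.Quotient.surjective_mk' I x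
  obtain ⟨y, rfl⟩ := LieSubmodule.Quotient.surjective_mk' I y
  obtain ⟨z, rfl⟩ := LieSubmodule.Quotient.surjective_mk' I z
  exact (congrArg (LieSubmodule.Quotient.mk' I) (h x y z)).trans (map_zero _)

theorem exists_lieHom_surjective_quotient {K L : Type} [Field K] [LieRing L] [LieAlgebra K L]
    (I : LieIdeal K L) : ∃ f : L →ₗ⁅K⁆ L ⧸ I, Function.Surjective f :=
  ⟨{ I.toSubmodule.mkQ with map_lie' := rfl }, I.toSubmodule.mkQ_surjective⟩

theorem HasSigma.of_surjective {K L L' : Type} [Field K] [LieRing L] [LieAlgebra K L]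
    [LieRing L'] [LieAlgebra K L'] {n₀ t₀ : ℕ} (h : HasSigma K L' n₀ t₀)
    (f : L →ₗ⁅K⁆ L') (hf : Function.Surjective f) : HasSigma K L n₀ t₀ := by
  obtain ⟨M, i₁, i₂, i₃, hM, g, hg⟩ := h
  exact ⟨M, i₁, i₂, i₃, hM, g.comp f, hg.comp hf⟩

theorem exists_submodule_le_finrank_eq {K V : Type*} [Field K] [AddCommGroup V] [Module K V]
    (N : Submodule K V) {k : ℕ} (hk : k ≤ Module.finrank K N) :
    ∃ J ≤ N, Module.finrank K J = k := by
  obtain ⟨v, hv⟩ := exists_linearIndependent_of_le_finrank hk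
  refine ⟨(Submodule.span K (Set.range v)).map N.subtype, Submodule.map_subtype_le _ _, ?_⟩
  rw [Submodule.finrank_map_subtype_eq, finrank_span_eq_card hv, Fintype.card_fin]

/-- Killing a central subspace of the derived algebra lowers its dimension to any `t₀ > 0`. -/
theorem hasSigma_of_le_finrank_commSubmodule {K L : Type} [Field K] [LieRing L] [LieAlgebra K L]
    [Module.Finite K L] (h : ∀ x y z : L, ⁅x, ⁅y, z⁆⁆ = 0) {n₀ t₀ : ℕ} (ht₀ : 0 < t₀)
    (hle : t₀ ≤ Module.finrank K (commSubmodule K L))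
    (hdim : Module.finrank K L = n₀ + Module.finrank K (commSubmodule K L)) :
    HasSigma K L n₀ t₀ := by
  obtain ⟨J, hJ, hJdim⟩ := exists_submodule_le_finrank_eq (commSubmodule K L)
    (Nat.sub_le (Module.finrank K (commSubmodule K L)) t₀)
  let I : LieIdeal K L :=
    { J with
      lie_mem := by
        intro x m hm
        rw [lie_eq_zero_of_mem_commSubmodule h (hJ hm)]
        exact J.zero_mem }
  have hI : I.toSubmodule = J := rfl
  have h₁ := finrank_commSubmodule_quotient_add K L I
  have h₂ := finrank_lieQuotient_add K L I
  rw [hI, inf_eq_right.mpr hJ] at h₁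
  rw [hI] at h₂
  have h₃ := Submodule.finrank_quotient_add_finrank (commSubmodule K (L ⧸ I))
  refine ⟨L ⧸ I, inferInstance, inferInstance, inferInstanceAs (Module.Finite K (L ⧸ J)),
    ⟨⟨lie_lie_quotient_eq_zero h I, fun h₀ => ?_⟩, by lia, by lia⟩,
    exists_lieHom_surjective_quotient I⟩
  have hbot : commSubmodule K (L ⧸ I) = ⊥ := by
    rw [commSubmodule_eq_span, Submodule.span_eq_bot]
    rintro _ ⟨x, y, rfl⟩
    exact h₀ x y
  rw [hbot, finrank_bot] at h₁
  lia

/-- For `x ∉ [L,L]`, the quotient by the ideal `Kx + [x,L]` lowers `dim L/[L,L]` by one and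
`dim [L,L]` by at most `dim L/[L,L] - 1`. -/
theorem exists_quotient_finrank {K L : Type} [Field K] [LieRing L] [LieAlgebra K L]
    [Module.Finite K L] (h : ∀ x y z : L, ⁅x, ⁅y, z⁆⁆ = 0) {m : ℕ}
    (hdim : Module.finrank K L = m + 1 + Module.finrank K (commSubmodule K L)) :
    ∃ I : LieIdeal K L,
      Module.finrank K (L ⧸ I) = m + Module.finrank K (commSubmodule K (L ⧸ I)) ∧
      Module.finrank K (commSubmodule K L) ≤ m + Module.finrank K (commSubmodule K (L ⧸ I)) := by
  obtain ⟨x, hx⟩ : ∃ x, x ∉ commSubmodule K L := by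
    by_contra! hall
    rw [(commSubmodule K L).eq_top_iff'.mpr hall, finrank_top] at hdim
    lia
  let A : L →ₗ[K] L := LieAlgebra.ad K L x
  have hA : ∀ y, A y = ⁅x, y⁆ := fun y => rfl
  have hAle : LinearMap.range A ≤ commSubmodule K L := by
    rintro _ ⟨y, rfl⟩
    exact lie_mem_commSubmodule K x y
  have hx₀ : x ≠ 0 := fun h₀ => hx (h₀ ▸ Submodule.zero_mem _)
  have hdisj : ∀ S ≤ commSubmodule K L, Disjoint (Submodule.span K {x}) S := fun S hS =>
    (Submodule.disjoint_span_singleton' hx₀).mpr (fun hmem => hx (hS hmem)) |>.symm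
  have hsup : ∀ S ≤ commSubmodule K L,
      Module.finrank K (Submodule.span K {x} ⊔ S : Submodule K L) = 1 + Module.finrank K S := by
    intro S hS
    have := Submodule.finrank_sup_add_finrank_inf_eq (Submodule.span K {x}) S
    rwa [(hdisj S hS).eq_bot, finrank_bot, add_zero, finrank_span_singleton hx₀] at this
  have hker : Submodule.span K {x} ⊔ commSubmodule K L ≤ LinearMap.ker A := by
    refine sup_le ?_ fun c hc => lie_eq_zero_of_mem_commSubmodule h hc x
    rw [Submodule.span_singleton_le_iff_mem]
    exact lie_self x
  have hker' := Submodule.finrank_mono hker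
  rw [hsup _ le_rfl] at hker'
  have hrank := LinearMap.finrank_range_add_finrank_ker A
  let I : LieIdeal K L :=
    { Submodule.span K {x} ⊔ LinearMap.range A with
      lie_mem := by
        intro y z hz
        obtain ⟨a, ha, b, hb, rfl⟩ := Submodule.mem_sup.mp hz
        obtain ⟨k, rfl⟩ := Submodule.mem_span_singleton.mp ha
        rw [lie_add, lie_eq_zero_of_mem_commSubmodule h (hAle hb), add_zero]
        refine Submodule.mem_sup_right ⟨-(k • y), ?_⟩
        rw [hA, lie_neg, lie_skew, smul_lie, lie_smul] }
  have hI : I.toSubmodule = Submodule.span K {x} ⊔ LinearMap.range A := rfl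
  have hinf : commSubmodule K L ⊓ I.toSubmodule = LinearMap.range A := by
    rw [hI, sup_comm, inf_comm, sup_inf_assoc_of_le _ hAle, (hdisj _ le_rfl).eq_bot, sup_bot_eq]
  have h₁ := finrank_commSubmodule_quotient_add K L I
  have h₂ := finrank_lieQuotient_add K L I
  rw [hinf] at h₁
  rw [hI, hsup _ hAle] at h₂
  exact ⟨I, by lia, by lia⟩

theorem hasSigma_of_finrank_le {K : Type} [Field K] {n₀ t₀ : ℕ} (ht₀ : 0 < t₀) (d : ℕ)
    {L : Type} [LieRing L] [LieAlgebra K L] [Module.Finite K L]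
    (h : ∀ x y z : L, ⁅x, ⁅y, z⁆⁆ = 0)
    (hdim : Module.finrank K L = n₀ + d + Module.finrank K (commSubmodule K L))
    (hle : ((n₀ + d : ℕ) : ℤ) * ((n₀ + d : ℕ) - 1) - n₀ * (n₀ - 1) + 2 * t₀ ≤
      2 * Module.finrank K (commSubmodule K L)) :
    HasSigma K L n₀ t₀ := by
  induction d generalizing L with
  | zero =>
    refine hasSigma_of_le_finrank_commSubmodule h ht₀ ?_ hdim
    simp only [add_zero] at hle
    lia
  | succ d ih =>
    obtain ⟨I, hI, hle'⟩ := exists_quotient_finrank (m := n₀ + d) h hdim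
    obtain ⟨f, hf⟩ := exists_lieHom_surjective_quotient I
    have : Module.Finite K (L ⧸ I) := inferInstanceAs (Module.Finite K (L ⧸ I.toSubmodule))
    refine (ih (lie_lie_quotient_eq_zero h I) hI ?_).of_surjective f hf
    zify at hle'
    push_cast at hle ⊢
    linarith

/-- Over an infinite field, if n ≥ n₀ ≥ 2, t₀ ≤ n₀(n₀−1)/2 and
2t ≥ n(n−1) − n₀(n₀−1) + 2t₀, then every finite-dimensional 2-step nilpotent Lie
algebra with dim L/[L,L] = n, dim [L,L] = t has property Σ(n₀,t₀). -/
theorem hasSigma_of_large_t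
    (K : Type) [Field K] [Infinite K] (n n₀ t t₀ : ℕ)
    (hn₀ : 2 ≤ n₀) (hn : n₀ ≤ n) (ht₀ : 0 < t₀) (ht : 0 < t)
    (ht₀top : 2 * t₀ ≤ n₀ * (n₀ - 1))
    (hineq : (n : ℤ) * ((n : ℤ) - 1) - (n₀ : ℤ) * ((n₀ : ℤ) - 1) + 2 * (t₀ : ℤ)
        ≤ 2 * (t : ℤ))
    (L : Type) [LieRing L] [LieAlgebra K L] [Module.Finite K L]
    (h2step : Is2StepNilpotent L)
    (hdim1 : Module.finrank K (L ⧸ commSubmodule K L) = n)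
    (hdim2 : Module.finrank K (commSubmodule K L) = t) :
    HasSigma K L n₀ t₀ := by
  obtain ⟨d, rfl⟩ := Nat.exists_eq_add_of_le hn
  have hdim := Submodule.finrank_quotient_add_finrank (commSubmodule K L)
  refine hasSigma_of_finrank_le ht₀ d h2step.1 (by lia) ?_
  rw [hdim2]
  exact hineq
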